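/- Let d ≥ 3, let v_1, …, v_d be distinct unit vectors in ℝ^d, b_1, …, b_d ∈ ℝ, A = {x ∈ ℝ^d : x·v_j ≤ b_j for j = 1,…,d}, and for t ∈ ℝ let A(t) = {x ∈ ℝ^d : x·v_j ≤ b_j + t for j = 1,…,d}. Then for any κ > 0 and u ∈ ℝ^d, sup_{x ∉ A(κ)∖A(−κ)} |∫_A u·∇φ_d(z − x) dz| ≤ d φ_1(κ) max_{1 ≤ j ≤ d} |u·v_j|, where φ_1(κ) = (2π)^{-1/2} e^{−κ²/2}. -/

import Mathlib

open MeasureTheory Matrix Real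

/-- the standard Gaussian density on `ℝ^d` -/
noncomputable def gaussPDF (d : ℕ) (z : Fin d → ℝ) : ℝ :=
  (2 * π) ^ (-(d : ℝ) / 2) * Real.exp (-(∑ i, z i ^ 2) / 2)

open Filter Topology ProbabilityTheory

lemma gaussPDF_eq_prod (d : ℕ) (z : Fin d → ℝ) :
    gaussPDF d z = ∏ i, gaussianPDFReal 0 1 (z i) := by
  unfold gaussPDF gaussianPDFReal
  rw [Finset.prod_mul_distrib, ← Real.exp_sum]
  congr 1
  · simp only [NNReal.coe_one, mul_one, Finset.prod_const, Finset.card_univ, Fintype.card_fin]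
    rw [Real.sqrt_eq_rpow, ← Real.rpow_neg (by positivity), ← Real.rpow_natCast,
      ← Real.rpow_mul (by positivity)]
    congr 1
    ring
  · congr 1
    simp only [NNReal.coe_one, mul_one, sub_zero]
    rw [← Finset.sum_div, Finset.sum_neg_distrib]

lemma gaussPDF_nonneg (d : ℕ) (z : Fin d → ℝ) : 0 ≤ gaussPDF d z := by
  unfold gaussPDF; positivity

lemma gaussPDF_continuous (d : ℕ) : Continuous (gaussPDF d) := by
  unfold gaussPDF; fun_prop

lemma gaussPDF_integrable (d : ℕ) : Integrable (gaussPDF d) := by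
  have : gaussPDF d = fun z => ∏ i, gaussianPDFReal 0 1 (z i) := by
    ext z; exact gaussPDF_eq_prod d z
  rw [this]
  exact Integrable.fintype_prod (fun i => integrable_gaussianPDFReal 0 1)

lemma exp_sq_integrable (d : ℕ) (a : ℝ) (ha : 0 < a) :
    Integrable (fun z : Fin d → ℝ => Real.exp (-a * ∑ i, z i ^ 2)) := by
  have : (fun z : Fin d → ℝ => Real.exp (-a * ∑ i, z i ^ 2)) =
      fun z => ∏ i, Real.exp (-a * z i ^ 2) := by
    ext z; rw [← Real.exp_sum, Finset.mul_sum]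
  rw [this]
  exact Integrable.fintype_prod (f := fun _ y => Real.exp (-a * y ^ 2))
    (fun i => integrable_exp_neg_mul_sq ha)

lemma marginal (d : ℕ) (v : Fin d → ℝ) (hv : ∑ i, v i ^ 2 = 1) :
    (volume.withDensity (fun y => ENNReal.ofReal (gaussPDF d y))).map
      (fun y : Fin d → ℝ => y ⬝ᵥ v) = gaussianReal 0 1 := by
  have hm : Measurable (fun y : Fin d → ℝ => y ⬝ᵥ v) := by
    apply Continuous.measurable; unfold dotProduct; fun_prop
  have hfin : IsFiniteMeasure (volume.withDensity (fun y => ENNReal.ofReal (gaussPDF d y))) :=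
    isFiniteMeasure_withDensity_ofReal (gaussPDF_integrable d).2
  apply Measure.ext_of_charFun
  ext t
  rw [charFun_apply_real, integral_map hm.aemeasurable (by fun_prop),
    integral_withDensity_eq_integral_toReal_smul
      ((gaussPDF_continuous d).measurable.ennreal_ofReal) (by simp)]
  have h1 : ∀ y : Fin d → ℝ, (ENNReal.ofReal (gaussPDF d y)).toReal •
      Complex.exp (t * ((y ⬝ᵥ v : ℝ) : ℂ) * Complex.I) =
      ∏ i, (gaussianPDFReal 0 1 (y i) • Complex.exp ((t * v i : ℝ) * (y i : ℂ) * Complex.I)) := by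
    intro y
    rw [ENNReal.toReal_ofReal (gaussPDF_nonneg d y), gaussPDF_eq_prod]
    simp only [Complex.real_smul]
    rw [Finset.prod_mul_distrib, ← Complex.exp_sum, Complex.ofReal_prod]
    congr 2
    simp only [dotProduct, Complex.ofReal_sum, Finset.mul_sum, Finset.sum_mul]
    apply Finset.sum_congr rfl
    intro i _
    push_cast
    ring
  simp_rw [h1]
  rw [integral_fintype_prod_volume_eq_prod (fun i (s : ℝ) =>
    gaussianPDFReal 0 1 s • Complex.exp ((t * v i : ℝ) * (s : ℂ) * Complex.I))]
  have h2 : ∀ i, ∫ s : ℝ, gaussianPDFReal 0 1 s • Complex.exp ((t * v i : ℝ) * (s : ℂ) * Complex.I)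
      = charFun (gaussianReal 0 1) (t * v i) := by
    intro i
    rw [charFun_apply_real, integral_gaussianReal_eq_integral_smul one_ne_zero]
  simp_rw [h2, charFun_gaussianReal]
  rw [← Complex.exp_sum]
  congr 1
  have h3 : (∑ i, (v i : ℂ) ^ 2) = 1 := by exact_mod_cast hv
  simp only [Complex.ofReal_mul, Complex.ofReal_zero, mul_zero, zero_mul, NNReal.coe_one,
    Complex.ofReal_one, one_mul, zero_sub, mul_pow]
  rw [Finset.sum_neg_distrib, ← Finset.sum_div, ← Finset.mul_sum, h3, mul_one]

lemma slab_bound (d : ℕ) (v : Fin d → ℝ) (hv : ∑ i, v i ^ 2 = 1) (a b : ℝ) (hab : a ≤ b) :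
    ∫ y, ({y : Fin d → ℝ | y ⬝ᵥ v ∈ Set.Icc a b}).indicator (gaussPDF d) y ≤
      (b - a) * (Real.sqrt (2 * π))⁻¹ := by
  have hm : Measurable (fun y : Fin d → ℝ => y ⬝ᵥ v) := by
    apply Continuous.measurable; unfold dotProduct; fun_prop
  have hS : MeasurableSet {y : Fin d → ℝ | y ⬝ᵥ v ∈ Set.Icc a b} := hm measurableSet_Icc
  rw [integral_indicator hS, integral_eq_lintegral_of_nonneg_ae
    (Eventually.of_forall (gaussPDF_nonneg d)) (gaussPDF_continuous d).aestronglyMeasurable,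
    ← withDensity_apply _ hS]
  have h1 : (volume.withDensity (fun y => ENNReal.ofReal (gaussPDF d y)))
      {y : Fin d → ℝ | y ⬝ᵥ v ∈ Set.Icc a b} = gaussianReal 0 1 (Set.Icc a b) := by
    rw [← marginal d v hv, Measure.map_apply hm measurableSet_Icc]; rfl
  rw [h1, gaussianReal_apply 0 one_ne_zero]
  apply ENNReal.toReal_le_of_le_ofReal (mul_nonneg (by linarith) (by positivity))
  calc _ ≤ ∫⁻ x in Set.Icc a b, ENNReal.ofReal ((Real.sqrt (2 * π))⁻¹) := by
        apply lintegral_mono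
        intro s
        apply ENNReal.ofReal_le_ofReal
        unfold gaussianPDFReal
        simp only [NNReal.coe_one, mul_one, sub_zero]
        apply mul_le_of_le_one_right (by positivity)
        rw [Real.exp_le_one_iff]
        have := sq_nonneg s
        linarith
    _ = _ := by
        rw [setLIntegral_const, Real.volume_Icc, mul_comm, ENNReal.ofReal_mul (by linarith)]

lemma tilt (d : ℕ) (y w : Fin d → ℝ) (hw : ∑ i, w i ^ 2 = 1) (k : ℝ) (hk : 0 ≤ k)
    (h : y ⬝ᵥ w ≤ -k) :
    gaussPDF d y ≤ Real.exp (-k ^ 2 / 2) * gaussPDF d (y + k • w) := by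
  unfold gaussPDF
  rw [mul_left_comm, ← Real.exp_add]
  gcongr
  have : ∑ i, (y + k • w) i ^ 2 = ∑ i, y i ^ 2 + 2 * k * (y ⬝ᵥ w) + k ^ 2 * ∑ i, w i ^ 2 := by
    simp only [dotProduct, Finset.mul_sum, ← Finset.sum_add_distrib]
    apply Finset.sum_congr rfl
    intro i _
    simp only [Pi.add_apply, Pi.smul_apply, smul_eq_mul]
    ring
  rw [this, hw]
  nlinarith

lemma slab_tilt (d : ℕ) (v w : Fin d → ℝ) (hv : ∑ i, v i ^ 2 = 1) (hw : ∑ i, w i ^ 2 = 1)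
    (a b k : ℝ) (hab : a ≤ b) (hk : 0 ≤ k) (S : Set (Fin d → ℝ)) (hSm : MeasurableSet S)
    (hS : ∀ y ∈ S, y ⬝ᵥ v ∈ Set.Icc a b ∧ y ⬝ᵥ w ≤ -k) :
    ∫ y, S.indicator (gaussPDF d) y ≤
      (b - a) * ((Real.sqrt (2 * π))⁻¹ * Real.exp (-k ^ 2 / 2)) := by
  set c := k * (w ⬝ᵥ v) with hc
  have hm : Measurable (fun y : Fin d → ℝ => y ⬝ᵥ v) := by
    apply Continuous.measurable; unfold dotProduct; fun_prop
  have hT : MeasurableSet {y : Fin d → ℝ | y ⬝ᵥ v ∈ Set.Icc (a + c) (b + c)} :=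
    hm measurableSet_Icc
  set g := ({y : Fin d → ℝ | y ⬝ᵥ v ∈ Set.Icc (a + c) (b + c)}).indicator (gaussPDF d) with hg
  have hgi : Integrable g := (gaussPDF_integrable d).indicator hT
  have hg0 : ∀ y, 0 ≤ g y := fun y => Set.indicator_nonneg (fun z _ => gaussPDF_nonneg d z) y
  calc ∫ y, S.indicator (gaussPDF d) y ≤ ∫ y, Real.exp (-k ^ 2 / 2) * g (y + k • w) := by
        apply integral_mono ((gaussPDF_integrable d).indicator hSm)
          ((hgi.comp_add_right (k • w)).const_mul _)
        intro y
        by_cases hy : y ∈ S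
        · obtain ⟨h1, h2⟩ := hS y hy
          have h3 : y + k • w ∈ {y : Fin d → ℝ | y ⬝ᵥ v ∈ Set.Icc (a + c) (b + c)} := by
            simp only [Set.mem_ofPred_eq, add_dotProduct, smul_dotProduct, smul_eq_mul, Set.mem_Icc]
            exact ⟨by linarith [h1.1], by linarith [h1.2]⟩
          simp only [hg, Set.indicator_of_mem hy, Set.indicator_of_mem h3]
          exact tilt d y w hw k hk h2
        · simp only [Set.indicator_of_notMem hy]
          exact mul_nonneg (Real.exp_nonneg _) (hg0 _)
    _ = Real.exp (-k ^ 2 / 2) * ∫ y, g y := by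
        rw [integral_const_mul, integral_add_right_eq_self g]
    _ ≤ Real.exp (-k ^ 2 / 2) * (((b + c) - (a + c)) * (Real.sqrt (2 * π))⁻¹) := by
        gcongr
        exact slab_bound d v hv _ _ (by linarith)
    _ = _ := by ring

lemma gaussPDF_hasFDerivAt_apply (d : ℕ) (y : Fin d → ℝ) (u : Fin d → ℝ) (t : ℝ) :
    HasDerivAt (fun s : ℝ => gaussPDF d (y + s • u)) (fderiv ℝ (gaussPDF d) (y + t • u) u) t := by
  have h1 : Differentiable ℝ (gaussPDF d) := by unfold gaussPDF; fun_prop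
  have h2 : HasDerivAt (fun s : ℝ => y + s • u) u t := by
    simpa using ((hasDerivAt_id t).smul_const u).const_add y
  exact (h1 (y + t • u)).hasFDerivAt.comp_hasDerivAt t h2

lemma fderiv_gaussPDF (d : ℕ) (y u : Fin d → ℝ) :
    fderiv ℝ (gaussPDF d) y u = - (y ⬝ᵥ u) * gaussPDF d y := by
  have h1 := gaussPDF_hasFDerivAt_apply d y u 0
  simp only [zero_smul, add_zero] at h1
  refine h1.unique ?_
  unfold gaussPDF
  have h2 : HasDerivAt (fun s : ℝ => ∑ i, (y + s • u) i ^ 2) (∑ i, 2 * (y i * u i)) 0 := by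
    apply HasDerivAt.fun_sum
    intro i _
    have : HasDerivAt (fun s : ℝ => (y + s • u) i) (u i) 0 := by
      simpa using ((hasDerivAt_id (0 : ℝ)).mul_const (u i)).const_add (y i)
    refine (this.fun_pow 2).congr_deriv ?_
    simp only [zero_smul, add_zero]
    norm_num
    ring
  have h3 := ((h2.fun_neg.div_const 2).exp).const_mul ((2 * π) ^ (-(d : ℝ) / 2))
  refine h3.congr_deriv ?_
  simp only [zero_smul, add_zero, dotProduct, ← Finset.mul_sum]
  ring

lemma fderiv_bound (d : ℕ) (y u : Fin d → ℝ) (t : ℝ) (ht : |t| ≤ 1) :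
    ‖fderiv ℝ (gaussPDF d) (y + t • u) u‖ ≤
      ((2 * π) ^ (-(d : ℝ) / 2) * (2 + (∑ i, u i ^ 2) / 2) * Real.exp ((∑ i, u i ^ 2) / 4)) *
        Real.exp (-(1 / 8) * ∑ i, y i ^ 2) := by
  rw [fderiv_gaussPDF, norm_mul, norm_neg, Real.norm_eq_abs, Real.norm_eq_abs,
    abs_of_nonneg (gaussPDF_nonneg _ _)]
  set z := y + t • u with hz
  set U := ∑ i, u i ^ 2
  set Z := ∑ i, z i ^ 2 with hZ
  set Y := ∑ i, y i ^ 2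
  have hU : 0 ≤ U := Finset.sum_nonneg (fun i _ => sq_nonneg _)
  have hZ0 : 0 ≤ Z := Finset.sum_nonneg (fun i _ => sq_nonneg _)
  have ht2 : t ^ 2 ≤ 1 := by rw [← sq_abs]; nlinarith [abs_nonneg t]
  have h1 : |z ⬝ᵥ u| ≤ Z / 2 + U / 2 := by
    unfold dotProduct
    calc _ ≤ ∑ i, |z i * u i| := Finset.abs_sum_le_sum_abs _ _
      _ ≤ ∑ i, (z i ^ 2 / 2 + u i ^ 2 / 2) := by
        apply Finset.sum_le_sum
        intro i _
        rw [abs_le]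
        constructor <;> nlinarith [sq_nonneg (z i + u i), sq_nonneg (z i - u i)]
      _ = _ := by rw [Finset.sum_add_distrib, ← Finset.sum_div, ← Finset.sum_div]
  have h2 : Y / 2 - U ≤ Z := by
    have : Y / 2 ≤ ∑ i, (z i ^ 2 + t ^ 2 * u i ^ 2) := by
      rw [Finset.sum_div]
      apply Finset.sum_le_sum
      intro i _
      simp only [hz, Pi.add_apply, Pi.smul_apply, smul_eq_mul]
      nlinarith [sq_nonneg (y i + 2 * (t * u i))]
    rw [Finset.sum_add_distrib, ← Finset.mul_sum] at this
    nlinarith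
  have h3 : |z ⬝ᵥ u| ≤ (2 + U / 2) * Real.exp (Z / 4) := by
    have e1 := Real.add_one_le_exp (Z / 4)
    have e2 : 1 ≤ Real.exp (Z / 4) := Real.one_le_exp (by positivity)
    nlinarith
  have h4 : gaussPDF d z = (2 * π) ^ (-(d : ℝ) / 2) * (Real.exp (-Z / 4) * Real.exp (-Z / 4)) := by
    unfold gaussPDF
    rw [← Real.exp_add]; congr 2; ring
  have h5 : Real.exp (Z / 4) * Real.exp (-Z / 4) = 1 := by
    rw [← Real.exp_add, ← Real.exp_zero]; congr 1; ring
  calc |z ⬝ᵥ u| * gaussPDF d z ≤ (2 + U / 2) * Real.exp (Z / 4) * gaussPDF d z :=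
        mul_le_mul_of_nonneg_right h3 (gaussPDF_nonneg _ _)
    _ = (2 * π) ^ (-(d : ℝ) / 2) * (2 + U / 2) * Real.exp (-Z / 4) := by
        rw [h4]
        linear_combination ((2 * π) ^ (-(d : ℝ) / 2) * (2 + U / 2) * Real.exp (-Z / 4)) * h5
    _ ≤ (2 * π) ^ (-(d : ℝ) / 2) * (2 + U / 2) * (Real.exp (U / 4) * Real.exp (-(1 / 8) * Y)) := by
        rw [← Real.exp_add]
        gcongr
        linarith
    _ = _ := by ring

lemma deriv_integral (d : ℕ) (A : Set (Fin d → ℝ)) (x u : Fin d → ℝ) :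
    HasDerivAt (fun t : ℝ => ∫ z in A, gaussPDF d (z - x + t • u))
      (∫ z in A, fderiv ℝ (gaussPDF d) (z - x) u) 0 := by
  have hc := gaussPDF_continuous d
  have key := hasDerivAt_integral_of_dominated_loc_of_deriv_le (μ := volume.restrict A)
    (F := fun (t : ℝ) z => gaussPDF d (z - x + t • u)) (x₀ := (0 : ℝ))
    (F' := fun (t : ℝ) z => fderiv ℝ (gaussPDF d) (z - x + t • u) u)
    (s := Metric.ball 0 1)
    (bound := fun z => ((2 * π) ^ (-(d : ℝ) / 2) * (2 + (∑ i, u i ^ 2) / 2) *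
        Real.exp ((∑ i, u i ^ 2) / 4)) * Real.exp (-(1 / 8) * ∑ i, (z - x) i ^ 2))
    (Metric.ball_mem_nhds _ one_pos) ?_ ?_ ?_ ?_ ?_ ?_
  · simpa using key.2
  · exact Eventually.of_forall fun t => (by fun_prop : Continuous _).aestronglyMeasurable
  · simpa using ((gaussPDF_integrable d).comp_sub_right x).restrict
  · simp_rw [fderiv_gaussPDF]
    apply Continuous.aestronglyMeasurable
    unfold dotProduct
    fun_prop
  · refine Eventually.of_forall fun z t ht => fderiv_bound d (z - x) u t ?_
    have h1 : |t| < 1 := by simpa using ht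
    exact h1.le
  · exact (((exp_sq_integrable d (1 / 8) (by norm_num)).comp_sub_right x).const_mul _).restrict
  · exact Eventually.of_forall fun z t _ => gaussPDF_hasFDerivAt_apply d (z - x) u t

lemma poly_meas (d : ℕ) (v : Fin d → (Fin d → ℝ)) (c : Fin d → ℝ) :
    MeasurableSet {y : Fin d → ℝ | ∀ j, y ⬝ᵥ v j ≤ c j} := by
  rw [Set.ofPred_forall]
  refine MeasurableSet.iInter fun j => measurableSet_le ?_ measurable_const
  apply Continuous.measurable; unfold dotProduct; fun_prop

lemma shift_eq (d : ℕ) (v : Fin d → (Fin d → ℝ)) (b : Fin d → ℝ) (x u : Fin d → ℝ) (t : ℝ) :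
    ∫ z in {y : Fin d → ℝ | ∀ j, y ⬝ᵥ v j ≤ b j}, gaussPDF d (z - x + t • u) =
    ∫ y, ({y : Fin d → ℝ | ∀ j, y ⬝ᵥ v j ≤ b j - x ⬝ᵥ v j + t * (u ⬝ᵥ v j)}).indicator
      (gaussPDF d) y := by
  rw [← integral_indicator (poly_meas d v b), ← integral_add_right_eq_self
    (({y : Fin d → ℝ | ∀ j, y ⬝ᵥ v j ≤ b j - x ⬝ᵥ v j + t * (u ⬝ᵥ v j)}).indicator
      (gaussPDF d)) (-x + t • u)]
  congr 1
  ext z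
  have e : z - x + t • u = z + (-x + t • u) := by abel
  simp only [Set.indicator, Set.mem_ofPred_eq, e]
  congr 1
  simp only [add_dotProduct, neg_dotProduct, smul_dotProduct, smul_eq_mul, eq_iff_iff]
  refine forall_congr' fun j => ?_
  constructor <;> intro h <;> linarith

lemma diff_bound (d : ℕ) (v : Fin d → (Fin d → ℝ)) (hv : ∀ j, ∑ i, v j i ^ 2 = 1)
    (h w : Fin d → ℝ) (W κ t : ℝ) (hW : ∀ j, |w j| ≤ W)
    (hk : 0 ≤ κ - |t| * W)
    (hh : (∃ j, h j < -κ) ∨ ∀ j, κ ≤ h j) :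
    |(∫ y, ({y : Fin d → ℝ | ∀ j, y ⬝ᵥ v j ≤ h j + t * w j}).indicator (gaussPDF d) y) -
     (∫ y, ({y : Fin d → ℝ | ∀ j, y ⬝ᵥ v j ≤ h j}).indicator (gaussPDF d) y)| ≤
     |t| * (d * ((Real.sqrt (2 * π))⁻¹ * Real.exp (-(κ - |t| * W) ^ 2 / 2)) * W) := by
  set k := κ - |t| * W with hkd
  have htw : ∀ j, |t * w j| ≤ |t| * W := fun j => by
    rw [abs_mul]; exact mul_le_mul_of_nonneg_left (hW j) (abs_nonneg t)
  set S : Fin d → Set (Fin d → ℝ) := fun j =>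
    {y | y ⬝ᵥ v j ∈ Set.Icc (h j + min 0 (t * w j)) (h j + max 0 (t * w j))} ∩
      {y | ∀ i, y ⬝ᵥ v i ≤ h i + |t * w i|} with hSd
  have hSm : ∀ j, MeasurableSet (S j) := fun j => by
    refine MeasurableSet.inter ?_ (poly_meas d v _)
    have hm : Measurable (fun y : Fin d → ℝ => y ⬝ᵥ v j) := by
      apply Continuous.measurable; unfold dotProduct; fun_prop
    exact hm measurableSet_Icc
  have hS : ∀ j, ∫ y, (S j).indicator (gaussPDF d) y ≤
      |t| * W * ((Real.sqrt (2 * π))⁻¹ * Real.exp (-k ^ 2 / 2)) := by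
    intro j
    have hmm : (h j + max 0 (t * w j)) - (h j + min 0 (t * w j)) ≤ |t| * W := by
      have := max_sub_min_eq_abs (0 : ℝ) (t * w j)
      simp only [sub_zero] at this
      linarith [htw j]
    have hle : h j + min 0 (t * w j) ≤ h j + max 0 (t * w j) := by
      linarith [min_le_left 0 (t * w j), le_max_left 0 (t * w j)]
    have hpos : 0 ≤ (Real.sqrt (2 * π))⁻¹ * Real.exp (-k ^ 2 / 2) := by positivity
    refine le_trans ?_ (mul_le_mul_of_nonneg_right hmm hpos)
    rcases hh with ⟨j0, hj0⟩ | hh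
    · refine slab_tilt d (v j) (v j0) (hv j) (hv j0) _ _ k hle hk _ (hSm j) ?_
      rintro y ⟨h1, h2⟩
      refine ⟨h1, ?_⟩
      have := h2 j0
      linarith [htw j0]
    · refine slab_tilt d (v j) (-v j) (hv j) (by simpa using hv j) _ _ k hle hk _ (hSm j) ?_
      rintro y ⟨h1, h2⟩
      refine ⟨h1, ?_⟩
      rw [dotProduct_neg]
      have h3 := h1.1
      have h4 : -|t * w j| ≤ min 0 (t * w j) := le_min (neg_nonpos.2 (abs_nonneg _)) (neg_abs_le _)
      linarith [htw j, hh j]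
  have hi := gaussPDF_integrable d
  have i1 := hi.indicator (poly_meas d v (fun j => h j + t * w j))
  have i2 := hi.indicator (poly_meas d v h)
  rw [← integral_sub i1 i2]
  calc _ ≤ ∫ y, |_| := abs_integral_le_integral_abs
    _ ≤ ∫ y, ∑ j, (S j).indicator (gaussPDF d) y := by
      apply integral_mono (i1.sub i2).abs (integrable_finsetSum _ fun j _ => hi.indicator (hSm j))
      intro y
      have hnn : ∀ j ∈ Finset.univ, 0 ≤ (S j).indicator (gaussPDF d) y := fun j _ =>
        Set.indicator_nonneg (fun z _ => gaussPDF_nonneg d z) y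
      have hsum : ∀ j, y ∈ S j → gaussPDF d y ≤ ∑ j, (S j).indicator (gaussPDF d) y := by
        intro j hj
        have := Finset.single_le_sum hnn (Finset.mem_univ j)
        rwa [Set.indicator_of_mem hj] at this
      have hg := gaussPDF_nonneg d y
      change |({y : Fin d → ℝ | ∀ j, y ⬝ᵥ v j ≤ h j + t * w j}).indicator (gaussPDF d) y -
        ({y : Fin d → ℝ | ∀ j, y ⬝ᵥ v j ≤ h j}).indicator (gaussPDF d) y| ≤
          ∑ j, (S j).indicator (gaussPDF d) y
      by_cases y1 : ∀ j, y ⬝ᵥ v j ≤ h j + t * w j <;> by_cases y2 : ∀ j, y ⬝ᵥ v j ≤ h j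
      · rw [Set.indicator_of_mem (s := {y : Fin d → ℝ | ∀ j, y ⬝ᵥ v j ≤ h j + t * w j}) y1,
          Set.indicator_of_mem (s := {y : Fin d → ℝ | ∀ j, y ⬝ᵥ v j ≤ h j}) y2, sub_self, abs_zero]
        exact Finset.sum_nonneg hnn
      · obtain ⟨j, hj⟩ := not_forall.1 y2
        have hj' := y1 j
        have : y ∈ S j := by
          refine ⟨⟨?_, ?_⟩, fun i => ?_⟩
          · linarith [min_le_left 0 (t * w j)]
          · linarith [le_max_right 0 (t * w j)]
          · linarith [y1 i, le_abs_self (t * w i)]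
        rw [Set.indicator_of_mem (s := {y : Fin d → ℝ | ∀ j, y ⬝ᵥ v j ≤ h j + t * w j}) y1,
          Set.indicator_of_notMem (s := {y : Fin d → ℝ | ∀ j, y ⬝ᵥ v j ≤ h j}) y2, sub_zero]
        rw [abs_of_nonneg hg]
        exact hsum j this
      · obtain ⟨j, hj⟩ := not_forall.1 y1
        have hj' := y2 j
        have : y ∈ S j := by
          refine ⟨⟨?_, ?_⟩, fun i => ?_⟩
          · linarith [min_le_right 0 (t * w j)]
          · linarith [le_max_left 0 (t * w j)]
          · linarith [y2 i, abs_nonneg (t * w i)]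
        rw [Set.indicator_of_notMem (s := {y : Fin d → ℝ | ∀ j, y ⬝ᵥ v j ≤ h j + t * w j}) y1,
          Set.indicator_of_mem (s := {y : Fin d → ℝ | ∀ j, y ⬝ᵥ v j ≤ h j}) y2, zero_sub]
        rw [abs_neg, abs_of_nonneg hg]
        exact hsum j this
      · rw [Set.indicator_of_notMem (s := {y : Fin d → ℝ | ∀ j, y ⬝ᵥ v j ≤ h j + t * w j}) y1,
          Set.indicator_of_notMem (s := {y : Fin d → ℝ | ∀ j, y ⬝ᵥ v j ≤ h j}) y2, sub_self, abs_zero]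
        exact Finset.sum_nonneg hnn
    _ = ∑ j, ∫ y, (S j).indicator (gaussPDF d) y :=
      integral_finsetSum _ fun j _ => hi.indicator (hSm j)
    _ ≤ ∑ j : Fin d, |t| * W * ((Real.sqrt (2 * π))⁻¹ * Real.exp (-k ^ 2 / 2)) :=
      Finset.sum_le_sum fun j _ => hS j
    _ = _ := by
      rw [Finset.sum_const, Finset.card_univ, Fintype.card_fin, nsmul_eq_mul]; ring

/-- the first-derivative integral is small away from the boundary region
`A(κ) \ A(−κ)`; here `fderiv ℝ (gaussPDF d) (z - x) u = u · ∇φ_d(z - x)`. -/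
theorem stmt9 :
    ∀ d : ℕ, 3 ≤ d →
    ∀ v : Fin d → (Fin d → ℝ), Function.Injective v → (∀ j, ∑ i, v j i ^ 2 = 1) →
    ∀ b : Fin d → ℝ, ∀ κ : ℝ, 0 < κ → ∀ u : Fin d → ℝ,
    ∀ x : Fin d → ℝ,
      x ∉ {y : Fin d → ℝ | ∀ j, y ⬝ᵥ v j ≤ b j + κ} \
          {y : Fin d → ℝ | ∀ j, y ⬝ᵥ v j ≤ b j + -κ} →
      |∫ z in {y : Fin d → ℝ | ∀ j, y ⬝ᵥ v j ≤ b j}, fderiv ℝ (gaussPDF d) (z - x) u| ≤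
        d * ((Real.sqrt (2 * π))⁻¹ * Real.exp (-κ ^ 2 / 2)) * ⨆ j, |u ⬝ᵥ v j| := by
  intro d _ v _ hv b κ hκ u x hx
  set W := ⨆ j, |u ⬝ᵥ v j| with hWd
  have hW : ∀ j, |u ⬝ᵥ v j| ≤ W := fun j =>
    le_ciSup (f := fun j => |u ⬝ᵥ v j|) (Set.finite_range _).bddAbove j
  have hh : (∃ j, b j - x ⬝ᵥ v j < -κ) ∨ ∀ j, κ ≤ b j - x ⬝ᵥ v j := by
    by_cases h1 : ∀ j, x ⬝ᵥ v j ≤ b j + κ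
    · right
      intro j
      have h2 : ∀ j, x ⬝ᵥ v j ≤ b j + -κ := by
        by_contra h2
        exact hx ⟨h1, h2⟩
      linarith [h2 j]
    · left
      obtain ⟨j, hj⟩ := not_forall.1 h1
      exact ⟨j, by linarith⟩
  have hder := deriv_integral d {y : Fin d → ℝ | ∀ j, y ⬝ᵥ v j ≤ b j} x u
  rw [hasDerivAt_iff_tendsto_slope_zero] at hder
  have hlim : Tendsto (fun t : ℝ =>
      d * ((Real.sqrt (2 * π))⁻¹ * Real.exp (-(κ - |t| * W) ^ 2 / 2)) * W) (𝓝[≠] 0)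
      (𝓝 (d * ((Real.sqrt (2 * π))⁻¹ * Real.exp (-κ ^ 2 / 2)) * W)) := by
    have hc : Continuous (fun t : ℝ =>
      d * ((Real.sqrt (2 * π))⁻¹ * Real.exp (-(κ - |t| * W) ^ 2 / 2)) * W) := by fun_prop
    have := hc.tendsto 0
    simp only [abs_zero, zero_mul, sub_zero] at this
    exact this.mono_left nhdsWithin_le_nhds
  refine le_of_tendsto_of_tendsto hder.abs hlim ?_
  have hev : ∀ᶠ t : ℝ in 𝓝[≠] 0, 0 < κ - |t| * W := by
    have hc : Continuous (fun t : ℝ => κ - |t| * W) := by fun_prop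
    have h0 := hc.tendsto 0
    simp only [abs_zero, zero_mul, sub_zero] at h0
    exact (h0.mono_left nhdsWithin_le_nhds).eventually (lt_mem_nhds hκ)
  filter_upwards [hev, self_mem_nhdsWithin] with t ht ht0
  have htpos : 0 < |t| := abs_pos.2 ht0
  have hb := diff_bound d v hv (fun j => b j - x ⬝ᵥ v j) (fun j => u ⬝ᵥ v j) W κ t hW ht.le hh
  have e0 := shift_eq d v b x u 0
  simp only [zero_mul, add_zero] at e0
  rw [zero_add, shift_eq d v b x u t, e0, smul_eq_mul, abs_mul, abs_inv, inv_mul_le_iff₀ htpos]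
  exact hb
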